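/- Let G = (V, E) be a finite simple graph with n = |V| vertices and set T = n. Let A = {(u,v) : {u,v} ∈ E} be the set of directed edges obtained by replacing each edge by two oppositely directed edges. Call a triple (s, x, y) with s : V → {0,1}, x : V → {0,1,…,T}, and y : A → {0,1} feasible if: (i) for every v ∈ V, s(v) + Σ_{(u,v) ∈ A} y(u,v) = 1; (ii) for every (u,v) ∈ A, x(u) − x(v) + (T+1)·y(u,v) ≤ T; and (iii) for every (u,v) ∈ A and every w ∈ N(u) \ {v}, x(w) − x(v) + (T+1)·y(u,v) ≤ T. Then the minimum of Σ_{v ∈ V} s(v) over all feasible triples (s, x, y) equals the zero forcing number Z(G). -/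

import Mathlib

/-- A set `C` is closed under the zero forcing color change rule:
whenever a vertex `u ∈ C` has exactly one neighbor outside `C`,
that neighbor also belongs to `C`. -/
def ZFClosed {V : Type*} (G : SimpleGraph V) (C : Set V) : Prop :=
  ∀ u ∈ C, ∀ w : V, G.neighborSet u \ C = {w} → w ∈ C

/-- The zero forcing closure of `S`: the smallest set containing `S`
that is closed under the color change rule. -/
def zfClosure {V : Type*} (G : SimpleGraph V) (S : Set V) : Set V :=
  ⋂₀ {C : Set V | S ⊆ C ∧ ZFClosed G C}

/-- A fort: a nonempty set such that no vertex outside it has exactly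
one neighbor inside it. -/
def IsFort {V : Type*} (G : SimpleGraph V) (F : Set V) : Prop :=
  F.Nonempty ∧ ∀ v ∉ F, ¬ ∃ w : V, G.neighborSet v ∩ F = {w}

/-- The zero forcing number: minimum cardinality of a zero forcing set. -/
noncomputable def zfNumber {V : Type*} (G : SimpleGraph V) : ℕ :=
  sInf {k : ℕ | ∃ Z : Set V, zfClosure G Z = Set.univ ∧ Z.ncard = k}

/-- The level function `x` witnesses that the vertices of `C` can be infected starting from `Z`:
every vertex of `C` outside `Z` is forced by a vertex all of whose other neighbors, like itself,
lie in `C` at a lower level. -/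
def IsForcingLevel {V : Type*} (G : SimpleGraph V) (Z C : Set V) (x : V → ℕ) : Prop :=
  ∀ v ∈ C, v ∉ Z → ∃ u ∈ C, G.Adj u v ∧ x u < x v ∧
    ∀ w, G.Adj u w → w ≠ v → w ∈ C ∧ x w < x v

theorem subset_zfClosure {V : Type*} (G : SimpleGraph V) (S : Set V) : S ⊆ zfClosure G S :=
  Set.subset_sInter fun _ hC => hC.1

theorem zfClosure_eq_univ_iff {V : Type*} (G : SimpleGraph V) (S : Set V) :
    zfClosure G S = Set.univ ↔ ∀ C : Set V, S ⊆ C → ZFClosed G C → C = Set.univ := by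
  simp [zfClosure, Set.sInter_eq_univ]

theorem exists_zero_forcing_ncard_eq_zfNumber {V : Type*} (G : SimpleGraph V) :
    ∃ Z : Set V, zfClosure G Z = Set.univ ∧ Z.ncard = zfNumber G :=
  Nat.sInf_mem (s := {k : ℕ | ∃ Z : Set V, zfClosure G Z = Set.univ ∧ Z.ncard = k})
    ⟨_, Set.univ, Set.univ_subset_iff.mp (subset_zfClosure G _), rfl⟩

theorem zfNumber_le_ncard {V : Type*} {G : SimpleGraph V} {Z : Set V}
    (hZ : zfClosure G Z = Set.univ) : zfNumber G ≤ Z.ncard :=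
  Nat.sInf_le ⟨Z, hZ, rfl⟩

/-- A force by `u` on `w` extends a forcing level by one vertex. -/
theorem IsForcingLevel.update_insert {V : Type*} [DecidableEq V] {G : SimpleGraph V}
    {Z C : Set V} {x : V → ℕ} (h : IsForcingLevel G Z C x) {u w : V} {k : ℕ}
    (hx : ∀ v ∈ C, x v < k) (hu : u ∈ C) (hw : G.neighborSet u \ C = {w}) :
    IsForcingLevel G Z (insert w C) (Function.update x w k) := by
  have hwm : w ∈ G.neighborSet u \ C := hw ▸ Set.mem_singleton w
  have hne : ∀ v ∈ C, v ≠ w := fun v hv => ne_of_mem_of_not_mem hv hwm.2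
  have hold : ∀ v ∈ C, Function.update x w k v = x v := fun v hv =>
    Function.update_of_ne (hne v hv) _ _
  rintro v (rfl | hv) hvZ
  · refine ⟨u, Or.inr hu, hwm.1, ?_, fun a ha hav => ?_⟩
    · rw [hold u hu, Function.update_self]
      exact hx u hu
    · have haC : a ∈ C := by
        by_contra haC
        exact hav (hw.subset ⟨ha, haC⟩)
      refine ⟨Or.inr haC, ?_⟩
      rw [hold a haC, Function.update_self]
      exact hx a haC
  · obtain ⟨b, hb, hbv, hlt, hall⟩ := h v hv hvZ
    refine ⟨b, Or.inr hb, hbv, ?_, fun a ha hav => ?_⟩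
    · rwa [hold b hb, hold v hv]
    · obtain ⟨haC, halt⟩ := hall a ha hav
      refine ⟨Or.inr haC, ?_⟩
      rwa [hold a haC, hold v hv]

theorem exists_isForcingLevel_of_zfClosure_eq_univ {V : Type*} [Fintype V] {G : SimpleGraph V}
    {Z : Set V} (hZ : zfClosure G Z = Set.univ) :
    ∃ x : V → ℕ, (∀ v, x v ≤ Fintype.card V) ∧ IsForcingLevel G Z Set.univ x := by
  classical
  obtain ⟨C, hC⟩ := (Set.toFinite {C : Set V | Z ⊆ C ∧ ∃ x : V → ℕ,
    (∀ v ∈ C, x v ≤ C.ncard) ∧ IsForcingLevel G Z C x}).exists_maximal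
    ⟨Z, subset_rfl, fun _ => 0, fun _ _ => Nat.zero_le _, fun _ hv hv' => absurd hv hv'⟩
  obtain ⟨hZC, x, hx, hlev⟩ := hC.prop
  have hclosed : ZFClosed G C := by
    intro u hu w hw
    have hwC : w ∉ C := (hw ▸ Set.mem_singleton w : w ∈ G.neighborSet u \ C).2
    refine hC.le_of_ge (y := insert w C) ⟨hZC.trans (Set.subset_insert w C),
      Function.update x w (C.ncard + 1), ?_,
      hlev.update_insert (fun v hv => Nat.lt_succ_of_le (hx v hv)) hu hw⟩
      (Set.subset_insert w C) (Set.mem_insert w C)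
    intro v hv
    rw [Set.ncard_insert_of_notMem hwC]
    rcases hv with rfl | hv
    · simp
    · rw [Function.update_of_ne (ne_of_mem_of_not_mem hv hwC)]
      exact (hx v hv).trans (Nat.le_succ _)
  obtain rfl := (zfClosure_eq_univ_iff G Z).mp hZ C hZC hclosed
  refine ⟨x, fun v => ?_, hlev⟩
  simpa [Set.ncard_univ] using hx v (Set.mem_univ v)

/-- A set is zero forcing as soon as it admits a forcing level on the whole vertex set. -/
theorem IsForcingLevel.zfClosure_eq_univ {V : Type*} {G : SimpleGraph V} {Z : Set V} {x : V → ℕ}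
    (h : IsForcingLevel G Z Set.univ x) : zfClosure G Z = Set.univ := by
  rw [zfClosure_eq_univ_iff]
  intro C hZC hC
  rw [Set.eq_univ_iff_forall]
  intro v
  induction hn : x v using Nat.strong_induction_on generalizing v with
  | _ n ih =>
    by_contra hv
    obtain ⟨u, -, huv, hlt, hall⟩ := h v (Set.mem_univ v) (fun hvZ => hv (hZC hvZ))
    refine hv (hC u (ih _ (hn ▸ hlt) u rfl) v ?_)
    ext w
    refine ⟨fun hw => ?_, ?_⟩
    · by_contra hwv
      exact hw.2 (ih _ (hn ▸ (hall w hw.1 hwv).2) w rfl)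
    · rintro rfl
      exact ⟨huv, hv⟩

theorem sum_eq_ncard_of_zero_one {V : Type*} [Fintype V] {s : V → ℤ}
    (hs : ∀ v, 0 ≤ s v ∧ s v ≤ 1) : ∑ v, s v = ({v | s v = 1} : Set V).ncard := by
  classical
  rw [Set.ncard_eq_toFinset_card', Set.toFinset_ofPred, Finset.card_filter, Nat.cast_sum]
  refine Finset.sum_congr rfl fun v _ => ?_
  have := hs v
  split_ifs <;> push_cast <;> omega

theorem infection_ip_optimum_eq_zf_number {V : Type*} [Fintype V] [DecidableEq V]
    (G : SimpleGraph V) [DecidableRel G.Adj] :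
    IsLeast
      {m : ℤ | ∃ (s x : V → ℤ) (y : V → V → ℤ),
        ((∀ v : V, 0 ≤ s v ∧ s v ≤ 1) ∧
         (∀ v : V, 0 ≤ x v ∧ x v ≤ (Fintype.card V : ℤ)) ∧
         (∀ u v : V, G.Adj u v → (0 ≤ y u v ∧ y u v ≤ 1)) ∧
         (∀ v : V, s v + ∑ u ∈ G.neighborFinset v, y u v = 1) ∧
         (∀ u v : V, G.Adj u v →
           x u - x v + ((Fintype.card V : ℤ) + 1) * y u v ≤ (Fintype.card V : ℤ)) ∧
         (∀ u v : V, G.Adj u v → ∀ w ∈ G.neighborSet u \ {v},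
           x w - x v + ((Fintype.card V : ℤ) + 1) * y u v ≤ (Fintype.card V : ℤ))) ∧
        ∑ v : V, s v = m}
      (zfNumber G : ℤ) := by
  classical
  refine ⟨?_, ?_⟩
  · obtain ⟨Z, hZ, hcard⟩ := exists_zero_forcing_ncard_eq_zfNumber G
    obtain ⟨x, hx, hlev⟩ := exists_isForcingLevel_of_zfClosure_eq_univ hZ
    have hforcer : ∀ v, ∃ u, v ∉ Z → G.Adj u v ∧ x u < x v ∧
        ∀ w, G.Adj u w → w ≠ v → x w < x v := by
      intro v
      by_cases hv : v ∈ Z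
      · exact ⟨v, fun h => absurd hv h⟩
      · obtain ⟨u, -, huv, hlt, hall⟩ := hlev v (Set.mem_univ v) hv
        exact ⟨u, fun _ => ⟨huv, hlt, fun w hw hwv => (hall w hw hwv).2⟩⟩
    choose f hf using hforcer
    have hs : ∀ v, (0 : ℤ) ≤ (if v ∈ Z then 1 else 0) ∧ (if v ∈ Z then 1 else 0) ≤ (1 : ℤ) := by
      intro v
      split_ifs <;> simp
    refine ⟨fun v => if v ∈ Z then 1 else 0, fun v => x v,
      fun u v => if v ∉ Z ∧ u = f v then 1 else 0,
      ⟨hs, fun v => ⟨Int.natCast_nonneg _, Int.ofNat_le.mpr (hx v)⟩, ?_, ?_, ?_, ?_⟩, ?_⟩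
    · intro u v _
      dsimp only
      split_ifs <;> simp
    · intro v
      by_cases hv : v ∈ Z
      · simp [hv]
      · simp [hv, (hf v hv).1.symm]
    · intro u v _
      have := hx u
      dsimp only
      split_ifs with h
      · have := (hf v h.1).2.1
        rw [← h.2] at this
        omega
      · omega
    · intro u v _ w hw
      have := hx w
      dsimp only
      split_ifs with h
      · have := (hf v h.1).2.2 w (h.2 ▸ hw.1) hw.2
        omega
      · omega
    · rw [sum_eq_ncard_of_zero_one hs, ← hcard]
      simp
  · rintro m ⟨s, x, y, ⟨hs, hx, hy, hsum, hforce, hforce'⟩, rfl⟩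
    rw [sum_eq_ncard_of_zero_one hs, Nat.cast_le]
    refine zfNumber_le_ncard (IsForcingLevel.zfClosure_eq_univ (x := fun v => (x v).toNat) ?_)
    intro v _ hv
    have hsv : s v ≠ 1 := hv
    obtain ⟨u, hu, hyu⟩ : ∃ u ∈ G.neighborFinset v, y u v ≠ 0 := by
      apply Finset.exists_ne_zero_of_sum_ne_zero
      have := hsum v
      omega
    have huv : G.Adj u v := ((G.mem_neighborFinset v u).mp hu).symm
    have hyuv : y u v = 1 := by
      have := hy u v huv
      omega
    refine ⟨u, Set.mem_univ u, huv, ?_, fun w hw hwv => ⟨Set.mem_univ w, ?_⟩⟩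
    · have h := hforce u v huv
      have := hx u
      rw [hyuv] at h
      dsimp only
      omega
    · have h := hforce' u v huv w ⟨hw, hwv⟩
      have := hx w
      rw [hyuv] at h
      dsimp only
      omega
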